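/- arXiv:2106.01135 — 2 statements merged into one kernel-verified Lean document; each statement's English description precedes it below -/
import Mathlib

section
/- In the setting of the per-product confidence-gap bound (T_i(ℓ) = #{τ ≤ ℓ : i ∈ S_τ}, v_{i,ℓ}^LCB ≤ v_i ≤ v_{i,ℓ}^UCB with gaps at most C₁√(v_i log(√N T⁴+1)/T_i(ℓ)) + C₂ log(√N T⁴+1)/T_i(ℓ) whenever i ∈ S_ℓ), assume in addition that |S_ℓ| ≤ K for all ℓ, that L ≤ T, and that v_i ≤ v_max ≤ 1 for all i ∈ {1,…,N}. Then there is a constant C depending only on C₁ and C₂ such that for every ℓ* ∈ {1,…,L}, both Σ_{ℓ=ℓ*}^L Σ_{i=1}^N 1_{i∈S_ℓ} (v_i − v_{i,ℓ}^LCB) and Σ_{ℓ=ℓ*}^L Σ_{i=1}^N 1_{i∈S_ℓ} (v_{i,ℓ}^UCB − v_i) are at most C · log(√N·T⁴ + 1)² · ( N + √(K·N·T·v_max) ). -/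
/-- Summing a function of the running count of `p` over the indices satisfying `p`
is the same as summing it over `1, …, n`, where `n` is the final count. -/
lemma sum_ite_running_count (p : ℕ → Prop) [DecidablePred p] (g : ℕ → ℝ) (m : ℕ) :
    (∑ l ∈ Finset.Icc 1 m, if p l then g ((Finset.Icc 1 l).filter p).card else 0)
      = ∑ k ∈ Finset.Icc 1 ((Finset.Icc 1 m).filter p).card, g k := by
  induction m with
  | zero => simp
  | succ m ih =>
    rw [Finset.sum_Icc_succ_top (by omega), ih]
    have hIcc : Finset.Icc 1 (m + 1) = insert (m + 1) (Finset.Icc 1 m) :=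
      (Finset.insert_Icc_right_eq_Icc_add_one (by omega)).symm
    have hmem : m + 1 ∉ (Finset.Icc 1 m).filter p := by simp
    by_cases hp : p (m + 1)
    · rw [if_pos hp, hIcc, Finset.filter_insert, if_pos hp, Finset.card_insert_of_notMem hmem,
        Finset.sum_Icc_succ_top (by omega)]
    · rw [if_neg hp, hIcc, Finset.filter_insert, if_neg hp, add_zero]

lemma sum_Icc_inv_sqrt_le (n : ℕ) :
    ∑ k ∈ Finset.Icc 1 n, (Real.sqrt k)⁻¹ ≤ 2 * Real.sqrt n := by
  induction n with
  | zero => simp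
  | succ n ih =>
    rw [Finset.sum_Icc_succ_top (by omega)]
    have ha : 0 ≤ Real.sqrt n := Real.sqrt_nonneg _
    have hb : 0 < Real.sqrt ((n + 1 : ℕ) : ℝ) := Real.sqrt_pos.2 (by positivity)
    have ha2 : Real.sqrt n ^ 2 = n := Real.sq_sqrt (by positivity)
    have hb2 : Real.sqrt ((n + 1 : ℕ) : ℝ) ^ 2 = n + 1 := by
      rw [Real.sq_sqrt (by positivity)]; push_cast; ring
    have key : (Real.sqrt ((n + 1 : ℕ) : ℝ))⁻¹
        ≤ 2 * Real.sqrt ((n + 1 : ℕ) : ℝ) - 2 * Real.sqrt n := by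
      rw [inv_le_iff_one_le_mul₀ hb]
      nlinarith [sq_nonneg (Real.sqrt ((n + 1 : ℕ) : ℝ) - Real.sqrt n)]
    linarith

lemma sum_Icc_inv_le_one_add_log (n : ℕ) :
    ∑ k ∈ Finset.Icc 1 n, (k : ℝ)⁻¹ ≤ 1 + Real.log n := by
  have h := harmonic_le_one_add_log n
  rw [harmonic_eq_sum_Icc] at h
  push_cast at h
  exact h

/-- The number of pairs `(i, l)` with `i ∈ S l` is at most the number of epochs times the
maximal assortment size. -/
lemma sum_card_filter_mem_le {N : ℕ} (S : ℕ → Finset (Fin N)) (K L : ℕ)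
    (hS : ∀ l, (S l).card ≤ K) :
    ∑ i : Fin N, ((Finset.Icc 1 L).filter (fun l => i ∈ S l)).card ≤ K * L := by
  simp_rw [Finset.card_filter]
  rw [Finset.sum_comm]
  calc ∑ l ∈ Finset.Icc 1 L, ∑ i : Fin N, (if i ∈ S l then 1 else 0)
      = ∑ l ∈ Finset.Icc 1 L, (S l).card := by simp
    _ ≤ ∑ _l ∈ Finset.Icc 1 L, K := Finset.sum_le_sum fun l _ => hS l
    _ = K * L := by simp [mul_comm]

lemma sum_sqrt_mul_le {ι : Type*} [Fintype ι] (v x : ι → ℝ) (vmax M : ℝ)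
    (hvmax : 0 ≤ vmax) (hv : ∀ i, v i ≤ vmax) (hx : ∀ i, 0 ≤ x i) (hM : ∑ i, x i ≤ M) :
    ∑ i, Real.sqrt (v i * x i) ≤ Real.sqrt (Fintype.card ι * (M * vmax)) := by
  apply Real.le_sqrt_of_sq_le
  calc (∑ i, Real.sqrt (v i * x i)) ^ 2
      ≤ (∑ i, Real.sqrt (vmax * x i)) ^ 2 := by
        gcongr with i
        · exact hx i
        · exact hv i
    _ ≤ Fintype.card ι * ∑ i, Real.sqrt (vmax * x i) ^ 2 := sq_sum_le_card_mul_sum_sq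
    _ = Fintype.card ι * ((∑ i, x i) * vmax) := by
        congr 1
        rw [Finset.sum_mul]
        exact Finset.sum_congr rfl fun i _ => by
          rw [Real.sq_sqrt (mul_nonneg hvmax (hx i)), mul_comm]
    _ ≤ Fintype.card ι * (M * vmax) := by gcongr

/-- Summed bound for a generic gap `d` controlled by a confidence radius with parameter `lam`. -/
lemma sum_gap_le {C₁ C₂ : ℝ} (hC₁ : 0 ≤ C₁) (hC₂ : 0 ≤ C₂) {N T L K : ℕ} (hLT : L ≤ T)
    (S : ℕ → Finset (Fin N)) (v : Fin N → ℝ) (d : Fin N → ℕ → ℝ) (vmax lam : ℝ)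
    (hS : ∀ l, (S l).card ≤ K) (hvmax : 0 ≤ vmax) (hv : ∀ i, 0 ≤ v i ∧ v i ≤ vmax)
    (hlam : 1 / 2 ≤ lam) (hlog : Real.log T ≤ lam)
    (hd : ∀ i, ∀ l ∈ Finset.Icc 1 L, i ∈ S l → d i l
      ≤ C₁ * Real.sqrt (v i * lam / (((Finset.Icc 1 l).filter (fun τ => i ∈ S τ)).card : ℝ))
        + C₂ * (lam / (((Finset.Icc 1 l).filter (fun τ => i ∈ S τ)).card : ℝ)))
    {l₀ : ℕ} (hl₀ : 1 ≤ l₀) :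
    (∑ l ∈ Finset.Icc l₀ L, ∑ i : Fin N, if i ∈ S l then d i l else 0)
      ≤ (8 * C₁ + 3 * C₂) * lam ^ 2 * ((N : ℝ) + Real.sqrt ((K : ℝ) * N * T * vmax)) := by
  have hlam0 : 0 ≤ lam := by linarith
  set n : Fin N → ℕ := fun i => ((Finset.Icc 1 L).filter (fun τ => i ∈ S τ)).card with hn
  set g : Fin N → ℕ → ℝ := fun i k => C₁ * Real.sqrt (v i * lam / k) + C₂ * (lam / k) with hg
  have hg0 : ∀ i k, 0 ≤ g i k := fun i k => by positivity
  have hnT : ∀ i, n i ≤ T := fun i =>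
    (Finset.card_filter_le _ _).trans (by simpa using hLT)
  have hprod : ∀ i, (∑ l ∈ Finset.Icc l₀ L, if i ∈ S l then d i l else 0)
      ≤ 2 * C₁ * Real.sqrt lam * Real.sqrt (v i * n i) + 3 * C₂ * lam ^ 2 := by
    intro i
    have hlogn : 1 + Real.log (n i) ≤ 3 * lam := by
      rcases Nat.eq_zero_or_pos (n i) with h | h
      · rw [h]; norm_num; linarith
      · have : Real.log (n i) ≤ Real.log T :=
          Real.log_le_log (by exact_mod_cast h) (by exact_mod_cast hnT i)
        linarith
    calc (∑ l ∈ Finset.Icc l₀ L, if i ∈ S l then d i l else 0)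
        ≤ ∑ l ∈ Finset.Icc l₀ L, if i ∈ S l then
            g i ((Finset.Icc 1 l).filter (fun τ => i ∈ S τ)).card else 0 := by
          refine Finset.sum_le_sum fun l hl => ?_
          rw [Finset.mem_Icc] at hl
          split_ifs with h
          · exact hd i l (Finset.mem_Icc.2 ⟨hl₀.trans hl.1, hl.2⟩) h
          · exact le_rfl
      _ ≤ ∑ l ∈ Finset.Icc 1 L, if i ∈ S l then
            g i ((Finset.Icc 1 l).filter (fun τ => i ∈ S τ)).card else 0 := by
          refine Finset.sum_le_sum_of_subset_of_nonneg (Finset.Icc_subset_Icc_left hl₀)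
            fun l _ _ => ?_
          split_ifs
          · exact hg0 _ _
          · exact le_rfl
      _ = ∑ k ∈ Finset.Icc 1 (n i), g i k := sum_ite_running_count _ _ _
      _ = C₁ * Real.sqrt (v i * lam) * ∑ k ∈ Finset.Icc 1 (n i), (Real.sqrt k)⁻¹
            + C₂ * lam * ∑ k ∈ Finset.Icc 1 (n i), (k : ℝ)⁻¹ := by
          rw [Finset.mul_sum, Finset.mul_sum, ← Finset.sum_add_distrib]
          refine Finset.sum_congr rfl fun k _ => ?_
          simp only [hg]
          rw [Real.sqrt_div (mul_nonneg (hv i).1 hlam0)]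
          ring
      _ ≤ C₁ * Real.sqrt (v i * lam) * (2 * Real.sqrt (n i)) + C₂ * lam * (3 * lam) := by
          gcongr
          · exact sum_Icc_inv_sqrt_le _
          · exact (sum_Icc_inv_le_one_add_log _).trans hlogn
      _ = 2 * C₁ * Real.sqrt lam * Real.sqrt (v i * n i) + 3 * C₂ * lam ^ 2 := by
          rw [Real.sqrt_mul (hv i).1, Real.sqrt_mul (hv i).1]
          ring
  have hcount : ∑ i, (n i : ℝ) ≤ (K : ℝ) * T := by
    exact_mod_cast (sum_card_filter_mem_le S K L hS).trans (Nat.mul_le_mul_left K hLT)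
  have hsqrt : ∑ i, Real.sqrt (v i * n i) ≤ Real.sqrt ((K : ℝ) * N * T * vmax) := by
    have h := sum_sqrt_mul_le v (fun i => (n i : ℝ)) vmax _ hvmax (fun i => (hv i).2)
      (fun i => Nat.cast_nonneg _) hcount
    rw [Fintype.card_fin] at h
    convert h using 2
    ring
  have hlamsqrt : Real.sqrt lam ≤ 4 * lam ^ 2 := by
    apply Real.sqrt_le_iff.2 ⟨by positivity, ?_⟩
    have h3 : (1 / 2 : ℝ) ^ 3 ≤ lam ^ 3 := by gcongr
    nlinarith [mul_le_mul_of_nonneg_left h3 hlam0]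
  rw [Finset.sum_comm]
  set X := Real.sqrt ((K : ℝ) * N * T * vmax) with hX
  have hX0 : 0 ≤ X := Real.sqrt_nonneg _
  calc (∑ i : Fin N, ∑ l ∈ Finset.Icc l₀ L, if i ∈ S l then d i l else 0)
      ≤ ∑ i : Fin N, (2 * C₁ * Real.sqrt lam * Real.sqrt (v i * n i) + 3 * C₂ * lam ^ 2) :=
        Finset.sum_le_sum fun i _ => hprod i
    _ = 2 * C₁ * Real.sqrt lam * ∑ i, Real.sqrt (v i * n i) + 3 * C₂ * lam ^ 2 * N := by
        rw [Finset.sum_add_distrib, ← Finset.mul_sum]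
        simp [mul_comm]
    _ ≤ 2 * C₁ * (4 * lam ^ 2) * X + 3 * C₂ * lam ^ 2 * N := by gcongr
    _ ≤ (8 * C₁ + 3 * C₂) * lam ^ 2 * (N + X) := by
        have h1 : 0 ≤ C₁ * lam ^ 2 * N := by positivity
        have h2 : 0 ≤ C₂ * lam ^ 2 * X := by positivity
        linarith


/-- Summed confidence-gap bound over all products (second point of the
auxiliary lemma on the estimates `v^LCB, v^UCB`). -/
theorem stmt_3 (C₁ C₂ : ℝ) (hC₁ : 0 ≤ C₁) (hC₂ : 0 ≤ C₂) :
    ∃ C : ℝ, ∀ (N T L K : ℕ), 0 < N → 0 < T → 0 < L → 0 < K → L ≤ T →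
    ∀ (S : ℕ → Finset (Fin N)) (v : Fin N → ℝ) (vLCB vUCB : Fin N → ℕ → ℝ) (vmax : ℝ),
    (∀ ℓ, (S ℓ).card ≤ K) →
    vmax ≤ 1 →
    (∀ i, 0 ≤ v i ∧ v i ≤ vmax) →
    (∀ i ℓ, vLCB i ℓ ≤ v i ∧ v i ≤ vUCB i ℓ) →
    (∀ (i : Fin N), ∀ ℓ ∈ Finset.Icc 1 L, i ∈ S ℓ →
      max (vUCB i ℓ - v i) (v i - vLCB i ℓ)
        ≤ C₁ * Real.sqrt (v i * Real.log (Real.sqrt N * (T : ℝ) ^ 4 + 1)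
              / (((Finset.Icc 1 ℓ).filter (fun τ => i ∈ S τ)).card : ℝ))
          + C₂ * (Real.log (Real.sqrt N * (T : ℝ) ^ 4 + 1)
              / (((Finset.Icc 1 ℓ).filter (fun τ => i ∈ S τ)).card : ℝ))) →
    ∀ ℓs ∈ Finset.Icc 1 L,
      (∑ ℓ ∈ Finset.Icc ℓs L, ∑ i : Fin N, if i ∈ S ℓ then v i - vLCB i ℓ else 0)
        ≤ C * Real.log (Real.sqrt N * (T : ℝ) ^ 4 + 1) ^ 2 *
            ((N : ℝ) + Real.sqrt ((K : ℝ) * N * T * vmax))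
      ∧
      (∑ ℓ ∈ Finset.Icc ℓs L, ∑ i : Fin N, if i ∈ S ℓ then vUCB i ℓ - v i else 0)
        ≤ C * Real.log (Real.sqrt N * (T : ℝ) ^ 4 + 1) ^ 2 *
            ((N : ℝ) + Real.sqrt ((K : ℝ) * N * T * vmax)) := by
  refine ⟨8 * C₁ + 3 * C₂, ?_⟩
  intro N T L K hN hT _ _ hLT S v vLCB vUCB vmax hS _ hv _ hgap ℓs hℓs
  have hN1 : 1 ≤ Real.sqrt N := Real.one_le_sqrt.2 (by exact_mod_cast hN)
  have hT1 : (1 : ℝ) ≤ T := by exact_mod_cast hT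
  have hT4 : (T : ℝ) ≤ (T : ℝ) ^ 4 := le_self_pow₀ hT1 (by norm_num)
  have hNT : (T : ℝ) ^ 4 ≤ Real.sqrt N * (T : ℝ) ^ 4 :=
    le_mul_of_one_le_left (by positivity) hN1
  have hlam : 1 / 2 ≤ Real.log (Real.sqrt N * (T : ℝ) ^ 4 + 1) := by
    have h : Real.log 2 ≤ Real.log (Real.sqrt N * (T : ℝ) ^ 4 + 1) :=
      Real.log_le_log (by norm_num) (by linarith)
    linarith [Real.log_two_gt_d9]
  have hlog : Real.log T ≤ Real.log (Real.sqrt N * (T : ℝ) ^ 4 + 1) :=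
    Real.log_le_log (by linarith) (by linarith)
  have hvmax : 0 ≤ vmax := (hv ⟨0, hN⟩).1.trans (hv ⟨0, hN⟩).2
  have hℓs1 := (Finset.mem_Icc.1 hℓs).1
  exact ⟨sum_gap_le hC₁ hC₂ hLT S v (fun i ℓ => v i - vLCB i ℓ) vmax _ hS hvmax hv hlam hlog
      (fun i ℓ hℓ hi => (le_max_right _ _).trans (hgap i ℓ hℓ hi)) hℓs1,
    sum_gap_le hC₁ hC₂ hLT S v (fun i ℓ => vUCB i ℓ - v i) vmax _ hS hvmax hv hlam hlog
      (fun i ℓ hℓ hi => (le_max_left _ _).trans (hgap i ℓ hℓ hi)) hℓs1⟩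
end

section
/- Fix N, T, K positive integers, weights v_i ≥ 0, and inventories q_i ≥ 0. Let 𝒮 be the family of subsets of {1,…,N} of size at most K and p_i(S) = 1_{i∈S} v_i/(1 + Σ_{j∈S} v_j). On a probability space, let (S_t)_{t=1}^T be 𝒮-valued and (c_t)_{t=1}^T be {0,1,…,N}-valued random variables such that for every t and every i ∈ {1,…,N}, the conditional probability that c_t = i given σ(S_1, c_1, …, S_{t−1}, c_{t−1}, S_t) equals p_i(S_t) almost surely, and almost surely Σ_{t=1}^T 1_{c_t = i} ≤ q_i for every i. Then the vector y defined by y_S = (1/T) Σ_{t=1}^T P(S_t = S) is a probability distribution on 𝒮 satisfying Σ_{S∈𝒮} y_S p_i(S) ≤ q_i/T for every i, and moreover for any prices r_i ≥ 0 with r_0 = 0, E[ Σ_{t=1}^T r_{c_t} ] = T · Σ_{S∈𝒮} y_S R(S), where R(S) = Σ_{i∈S} r_i p_i(S). -/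
open MeasureTheory Filter

/-- MNL purchase probability of product `i` under assortment `A`. -/
noncomputable def mnlProb (v : ℕ → ℝ) (i : ℕ) (A : Finset ℕ) : ℝ :=
  if i ∈ A then v i / (1 + ∑ j ∈ A, v j) else 0

/-- MNL expected revenue of assortment `A`. -/
noncomputable def mnlRev (v r : ℕ → ℝ) (A : Finset ℕ) : ℝ :=
  ∑ i ∈ A, r i * mnlProb v i A

/-- The integral of a function of a random variable with values in a finite set. -/
lemma integral_comp_eq_sum_measure {Ω α : Type*} [MeasurableSpace Ω] (μ : Measure Ω)
    [IsFiniteMeasure μ] (X : Ω → α)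
    (hX : MeasurableSpace.comap X ⊤ ≤ (inferInstance : MeasurableSpace Ω))
    (F : Finset α) (hF : ∀ ω, X ω ∈ F) (f : α → ℝ) :
    Integrable (fun ω => f (X ω)) μ ∧
      ∫ ω, f (X ω) ∂μ = ∑ a ∈ F, (μ {ω | X ω = a}).toReal * f a := by
  classical
  have hmeas : ∀ a, MeasurableSet {ω | X ω = a} := fun a => hX _ ⟨{a}, trivial, rfl⟩
  have hrep : (fun ω => f (X ω))
      = fun ω => ∑ a ∈ F, {ω | X ω = a}.indicator (fun _ => f a) ω := by
    funext ω
    simp [Set.indicator_apply, hF ω]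
  have hint : ∀ a ∈ F, Integrable ({ω | X ω = a}.indicator (fun _ => f a)) μ :=
    fun a _ => (integrable_const _).indicator (hmeas a)
  rw [hrep]
  refine ⟨integrable_finsetSum F hint, ?_⟩
  rw [integral_finsetSum F hint]
  refine Finset.sum_congr rfl fun a _ => ?_
  rw [integral_indicator_const _ (hmeas a), smul_eq_mul, Measure.real]

lemma sum_time_average_mul {α ι : Type*} (F : Finset α) (I : Finset ι) (τ : ℝ)
    (m : ι → α → ℝ) (f : α → ℝ) :
    ∑ a ∈ F, (τ * ∑ t ∈ I, m t a) * f a = τ * ∑ t ∈ I, ∑ a ∈ F, m t a * f a := by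
  rw [Finset.sum_comm, Finset.mul_sum]
  refine Finset.sum_congr rfl fun a _ => ?_
  rw [mul_assoc, Finset.sum_mul]

lemma mnlRev_eq_sum_of_subset (v r : ℕ → ℝ) {A B : Finset ℕ} (h : A ⊆ B) :
    mnlRev v r A = ∑ i ∈ B, r i * mnlProb v i A :=
  Finset.sum_subset h fun i _ hi => by simp [mnlProb, hi]

/-- The time-averaged distribution of the offered assortments is feasible for
the deterministic LP, and the policy's expected revenue equals `T` times its
LP objective value. -/
theorem stmt_10 {Ω : Type*} [MeasurableSpace Ω] (μ : Measure Ω) [IsProbabilityMeasure μ]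
    (N T K : ℕ) (hN : 0 < N) (hT : 0 < T) (hK : 0 < K)
    (v q : ℕ → ℝ) (hv : ∀ i, 0 ≤ v i) (hq : ∀ i, 0 ≤ q i)
    (S : ℕ → Ω → Finset ℕ) (c : ℕ → Ω → ℕ)
    (hSmeas : ∀ t, MeasurableSpace.comap (S t) ⊤ ≤ (inferInstance : MeasurableSpace Ω))
    (hcmeas : ∀ t, Measurable (c t))
    (hSval : ∀ t ω, S t ω ⊆ Finset.Icc 1 N ∧ (S t ω).card ≤ K)
    (hcval : ∀ t ω, c t ω ≤ N)
    (hcond : ∀ t ∈ Finset.Icc 1 T, ∀ i ∈ Finset.Icc 1 N,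
      μ[(fun ω => if c t ω = i then (1 : ℝ) else 0) |
          (⨆ s ∈ Finset.Icc 1 (t - 1),
            (MeasurableSpace.comap (S s) ⊤ ⊔ MeasurableSpace.comap (c s) ⊤))
          ⊔ MeasurableSpace.comap (S t) ⊤]
        =ᵐ[μ] fun ω => mnlProb v i (S t ω))
    (hinv : ∀ᵐ ω ∂μ, ∀ i ∈ Finset.Icc 1 N,
      (∑ t ∈ Finset.Icc 1 T, if c t ω = i then (1 : ℝ) else 0) ≤ q i) :
    (∀ A : Finset ℕ,
        0 ≤ (1 / (T : ℝ)) * ∑ t ∈ Finset.Icc 1 T, (μ {ω | S t ω = A}).toReal)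
    ∧ (∑ A ∈ (Finset.Icc 1 N).powerset.filter (fun A => A.card ≤ K),
        (1 / (T : ℝ)) * ∑ t ∈ Finset.Icc 1 T, (μ {ω | S t ω = A}).toReal) = 1
    ∧ (∀ i ∈ Finset.Icc 1 N,
        ∑ A ∈ (Finset.Icc 1 N).powerset.filter (fun A => A.card ≤ K),
          ((1 / (T : ℝ)) * ∑ t ∈ Finset.Icc 1 T, (μ {ω | S t ω = A}).toReal)
            * mnlProb v i A ≤ q i / T)
    ∧ (∀ r : ℕ → ℝ, (∀ i, 0 ≤ r i) → r 0 = 0 →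
        (∫ ω, ∑ t ∈ Finset.Icc 1 T, r (c t ω) ∂μ)
          = T * ∑ A ∈ (Finset.Icc 1 N).powerset.filter (fun A => A.card ≤ K),
              ((1 / (T : ℝ)) * ∑ t ∈ Finset.Icc 1 T, (μ {ω | S t ω = A}).toReal)
                * mnlRev v r A) := by
  set F := (Finset.Icc 1 N).powerset.filter (fun A => A.card ≤ K) with hFdef
  have hTpos : (0 : ℝ) < T := by exact_mod_cast hT
  have hF : ∀ t ω, S t ω ∈ F := fun t ω => by
    simpa [hFdef] using hSval t ω
  have hsum : ∀ t (f : Finset ℕ → ℝ),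
      ∑ A ∈ F, (μ {ω | S t ω = A}).toReal * f A = ∫ ω, f (S t ω) ∂μ := fun t f =>
    (integral_comp_eq_sum_measure μ (S t) (hSmeas t) F (hF t) f).2.symm
  have hpurchase_int : ∀ t i, Integrable (fun ω => if c t ω = i then (1 : ℝ) else 0) μ :=
    fun t i => (integral_comp_eq_sum_measure μ (c t) (hcmeas t).comap_le (Finset.range (N + 1))
      (fun ω => Finset.mem_range_succ_iff.2 (hcval t ω)) (fun k => if k = i then (1 : ℝ) else 0)).1
  have hpurchase : ∀ t ∈ Finset.Icc 1 T, ∀ i ∈ Finset.Icc 1 N,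
      ∫ ω, mnlProb v i (S t ω) ∂μ = ∫ ω, (if c t ω = i then (1 : ℝ) else 0) ∂μ := by
    intro t ht i hi
    rw [← integral_congr_ae (hcond t ht i hi)]
    exact integral_condExp (sup_le (iSup₂_le fun s _ => sup_le (hSmeas s) (hcmeas s).comap_le)
      (hSmeas t))
  refine ⟨fun A => by positivity, ?_, ?_, ?_⟩
  · have h := sum_time_average_mul F (Finset.Icc 1 T) (1 / (T : ℝ))
      (fun t A => (μ {ω | S t ω = A}).toReal) (fun _ => 1)
    simp only [hsum _ (fun _ => 1)] at h
    simpa [hTpos.ne'] using h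
  · intro i hi
    rw [sum_time_average_mul, Finset.sum_congr rfl fun t ht =>
      (hsum t (mnlProb v i)).trans (hpurchase t ht i hi),
      ← integral_finsetSum _ fun t _ => hpurchase_int t i, one_div_mul_eq_div]
    gcongr
    calc _ ≤ ∫ _, q i ∂μ := integral_mono_ae (integrable_finsetSum _ fun t _ => hpurchase_int t i)
            (integrable_const _) (hinv.mono fun ω h => h i hi)
      _ = q i := by simp
  · intro r _ hr0
    have hr : ∀ t ω, r (c t ω) = ∑ i ∈ Finset.Icc 1 N, r i * if c t ω = i then (1 : ℝ) else 0 := by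
      intro t ω
      rcases Nat.eq_zero_or_pos (c t ω) with h | h
      · simp [h, hr0]
      · simp [Nat.succ_le_of_lt h, hcval t ω]
    have hrev : ∀ t ∈ Finset.Icc 1 T, ∫ ω, r (c t ω) ∂μ = ∫ ω, mnlRev v r (S t ω) ∂μ := by
      intro t ht
      simp_rw [hr, fun ω => mnlRev_eq_sum_of_subset v r (hSval t ω).1]
      rw [integral_finsetSum _ fun i _ => (hpurchase_int t i).const_mul _,
        integral_finsetSum _ fun i _ => (integral_comp_eq_sum_measure μ (S t) (hSmeas t) F (hF t)
          (fun A => r i * mnlProb v i A)).1]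
      refine Finset.sum_congr rfl fun i hi => ?_
      rw [integral_const_mul, integral_const_mul, hpurchase t ht i hi]
    rw [sum_time_average_mul, ← mul_assoc, mul_one_div_cancel hTpos.ne', one_mul,
      integral_finsetSum _ fun t _ => (integral_comp_eq_sum_measure μ (c t) (hcmeas t).comap_le
        (Finset.range (N + 1)) (fun ω => Finset.mem_range_succ_iff.2 (hcval t ω)) r).1]
    exact Finset.sum_congr rfl fun t ht => (hrev t ht).trans (hsum t _).symm
end
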